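/- arXiv:1310.5223 — 4 statements merged into one kernel-verified Lean document; each statement's English description precedes it below -/
import Mathlib

section
/- Let N ≥ 2 be an integer and let V = ℂ^N be the standard representation of SL_N(ℂ), with dual representation V^*. Then: (i) the space of SL_N(ℂ)-invariant vectors in V^* ⊗ V has dimension exactly 1; (ii) for all nonnegative integers m, n with (m,n) ≠ (0,0), the space of SL_N(ℂ)-invariant vectors in (V^*)^{⊗m} ⊗ V^{⊗n} is nonzero if and only if N divides m − n. -/
open TensorProduct

/-- The tensor space `(V^*)^{⊗m} ⊗ V^{⊗n}` for `V = ℂ^N`. -/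
abbrev TensorSpace (N m n : ℕ) : Type :=
  (PiTensorProduct ℂ fun _ : Fin m => Module.Dual ℂ (Fin N → ℂ)) ⊗[ℂ]
    (PiTensorProduct ℂ fun _ : Fin n => (Fin N → ℂ))

/-- The standard action of `g ∈ SL_N(ℂ)` on `V = ℂ^N`. -/
noncomputable def stdAct (N : ℕ) (g : Matrix.SpecialLinearGroup (Fin N) ℂ) :
    (Fin N → ℂ) →ₗ[ℂ] (Fin N → ℂ) :=
  Matrix.toLin' (g : Matrix (Fin N) (Fin N) ℂ)

/-- The contragredient action of `g ∈ SL_N(ℂ)` on `V^*`: `(g • φ)(v) = φ(g⁻¹ v)`. -/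
noncomputable def dualAct (N : ℕ) (g : Matrix.SpecialLinearGroup (Fin N) ℂ) :
    Module.Dual ℂ (Fin N → ℂ) →ₗ[ℂ] Module.Dual ℂ (Fin N → ℂ) :=
  (Matrix.toLin' ((g⁻¹ : Matrix.SpecialLinearGroup (Fin N) ℂ) : Matrix (Fin N) (Fin N) ℂ)).dualMap

/-- The diagonal action of `g ∈ SL_N(ℂ)` on `(V^*)^{⊗m} ⊗ V^{⊗n}`. -/
noncomputable def slTensorAct (N m n : ℕ) (g : Matrix.SpecialLinearGroup (Fin N) ℂ) :
    TensorSpace N m n →ₗ[ℂ] TensorSpace N m n :=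
  TensorProduct.map (PiTensorProduct.map fun _ => dualAct N g)
    (PiTensorProduct.map fun _ => stdAct N g)

/-- The space of `SL_N(ℂ)`-invariant vectors in `(V^*)^{⊗m} ⊗ V^{⊗n}`. -/
noncomputable def slInvariants (N m n : ℕ) : Submodule ℂ (TensorSpace N m n) :=
  ⨅ g : Matrix.SpecialLinearGroup (Fin N) ℂ,
    LinearMap.eqLocus (slTensorAct N m n g) LinearMap.id

theorem TensorProduct.tmul_ne_zero_of_ne_zero {R V W : Type*} [CommSemiring R] [NoZeroDivisors R]
    [AddCommMonoid V] [Module R V] [Module.Projective R V] [AddCommMonoid W] [Module R W]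
    [Module.Projective R W] {v : V} {w : W} (hv : v ≠ 0) (hw : w ≠ 0) : v ⊗ₜ[R] w ≠ 0 := by
  obtain ⟨φ, hφ⟩ : ∃ φ : Module.Dual R V, φ v ≠ 0 :=
    not_forall.mp ((Module.forall_dual_apply_eq_zero_iff R v).not.mpr hv)
  obtain ⟨ψ, hψ⟩ : ∃ ψ : Module.Dual R W, ψ w ≠ 0 :=
    not_forall.mp ((Module.forall_dual_apply_eq_zero_iff R w).not.mpr hw)
  intro h
  have h' := congrArg (TensorProduct.dualDistrib R V W (φ ⊗ₜ ψ)) h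
  rw [TensorProduct.dualDistrib_apply, map_zero] at h'
  exact mul_ne_zero hφ hψ h'

theorem PiTensorProduct.map_smul_id {R M : Type*} [CommSemiring R] [AddCommMonoid M] [Module R M]
    {ι : Type*} [Fintype ι] (c : R) :
    PiTensorProduct.map (fun _ : ι => c • (LinearMap.id : M →ₗ[R] M)) =
      c ^ Fintype.card ι • LinearMap.id := by
  ext v
  simpa using (PiTensorProduct.tprod R).map_smul_univ (fun _ : ι => c) v

theorem TensorPower.map_mulEquiv {R M : Type*} [CommSemiring R] [AddCommMonoid M] [Module R M]
    {a b : ℕ} (f : M →ₗ[R] M) (x : ⨂[R]^a M) (y : ⨂[R]^b M) :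
    PiTensorProduct.map (fun _ => f) (TensorPower.mulEquiv (x ⊗ₜ[R] y)) =
      TensorPower.mulEquiv
        (PiTensorProduct.map (fun _ => f) x ⊗ₜ[R] PiTensorProduct.map (fun _ => f) y) := by
  have key : (PiTensorProduct.map (fun _ : Fin (a + b) => f)) ∘ₗ
        (TensorPower.mulEquiv (R := R) (M := M) (n := a) (m := b)).toLinearMap =
      (TensorPower.mulEquiv (R := R) (M := M) (n := a) (m := b)).toLinearMap ∘ₗ
        TensorProduct.map (PiTensorProduct.map fun _ => f) (PiTensorProduct.map fun _ => f) := by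
    ext v w
    simp only [LinearMap.compMultilinearMap_apply, TensorProduct.AlgebraTensorModule.curry_apply,
      LinearMap.restrictScalars_self, TensorProduct.curry_apply, LinearMap.coe_comp,
      LinearEquiv.coe_coe, Function.comp_apply, TensorProduct.map_tmul,
      PiTensorProduct.map_tprod, TensorPower.mulEquiv, LinearEquiv.trans_apply,
      PiTensorProduct.tmulEquiv_apply, PiTensorProduct.reindex_tprod]
    congr 1
    ext i
    refine Fin.addCases (fun i => ?_) (fun i => ?_) i <;> simp
  exact LinearMap.congr_fun key (x ⊗ₜ y)

/-- An endomorphism of determinant one of a space of dimension `d` fixes a nonzero tensor in the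
`d`-th tensor power: the antisymmetrization of a basis. -/
theorem exists_tensorPower_ne_zero_forall_det_eq_one {K W : Type*} [Field K] [CharZero K]
    [AddCommGroup W] [Module K W] {d : ℕ} (b : Module.Basis (Fin d) K W) :
    ∃ x : PiTensorProduct K (fun _ : Fin d => W), x ≠ 0 ∧
      ∀ f : W →ₗ[K] W, LinearMap.det f = 1 → PiTensorProduct.map (fun _ => f) x = x := by
  set A : W [⋀^Fin d]→ₗ[K] PiTensorProduct K (fun _ : Fin d => W) :=
    MultilinearMap.alternatization (PiTensorProduct.tprod K) with hA
  refine ⟨A b, fun h => ?_, fun f hf => ?_⟩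
  · have h1 : PiTensorProduct.lift b.det.toMultilinearMap (A b) = (d.factorial : K) := by
      rw [hA, MultilinearMap.alternatization_apply, map_sum]
      have : ∀ σ : Equiv.Perm (Fin d),
          PiTensorProduct.lift b.det.toMultilinearMap (Equiv.Perm.sign σ •
            (PiTensorProduct.tprod K).domDomCongr σ (b : Fin d → W)) = 1 := by
        intro σ
        rw [LinearMap.map_smul_of_tower, MultilinearMap.domDomCongr_apply,
          PiTensorProduct.lift.tprod]
        change Equiv.Perm.sign σ • b.det ((b : Fin d → W) ∘ σ) = 1
        rw [AlternatingMap.map_perm, b.det_self, smul_smul, ← sq, Int.units_sq, one_smul]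
      rw [Finset.sum_congr rfl fun σ _ => this σ]
      simp [Fintype.card_perm]
    rw [h, map_zero] at h1
    exact Nat.cast_ne_zero.mpr d.factorial_ne_zero h1.symm
  · have h1 : PiTensorProduct.map (fun _ => f) (A b) = A (f ∘ b) := by
      simp only [hA, MultilinearMap.alternatization_apply, map_sum]
      refine Finset.sum_congr rfl fun σ _ => ?_
      rw [LinearMap.map_smul_of_tower, MultilinearMap.domDomCongr_apply,
        MultilinearMap.domDomCongr_apply, PiTensorProduct.map_tprod]
      rfl
    rw [h1, ← sub_eq_zero, ← Module.forall_dual_apply_eq_zero_iff K]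
    intro φ
    have h2 := AlternatingMap.eq_smul_basis_det b (φ.compAlternatingMap A)
    have h3 := congrArg (fun B => B (f ∘ b)) h2
    have h4 : φ (A (f ∘ b)) = φ (A b) := by
      simpa [b.det_comp, hf, b.det_self] using h3
    rw [map_sub, h4, sub_self]

theorem mem_slInvariants {N m n : ℕ} {x : TensorSpace N m n} :
    x ∈ slInvariants N m n ↔ ∀ g, slTensorAct N m n g x = x := by
  simp [slInvariants, Submodule.mem_iInf, LinearMap.mem_eqLocus]

theorem det_stdAct (N : ℕ) (g : Matrix.SpecialLinearGroup (Fin N) ℂ) :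
    LinearMap.det (stdAct N g) = 1 := by
  rw [stdAct, LinearMap.det_toLin', g.det_coe]

theorem det_dualAct (N : ℕ) (g : Matrix.SpecialLinearGroup (Fin N) ℂ) :
    LinearMap.det (dualAct N g) = 1 := by
  rw [dualAct, LinearMap.det_dualMap, LinearMap.det_toLin', Matrix.SpecialLinearGroup.det_coe]

theorem slInvariants_add_ne_bot {N m n m' n' : ℕ} (h : slInvariants N m n ≠ ⊥)
    (h' : slInvariants N m' n' ≠ ⊥) : slInvariants N (m + m') (n + n') ≠ ⊥ := by
  obtain ⟨x, hx, hx0⟩ := Submodule.exists_mem_ne_zero_of_ne_bot h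
  obtain ⟨y, hy, hy0⟩ := Submodule.exists_mem_ne_zero_of_ne_bot h'
  rw [mem_slInvariants] at hx hy
  let e : TensorSpace N m n ⊗[ℂ] TensorSpace N m' n' ≃ₗ[ℂ] TensorSpace N (m + m') (n + n') :=
    TensorProduct.tensorTensorTensorComm ℂ _ _ _ _ ≪≫ₗ
      TensorProduct.congr TensorPower.mulEquiv TensorPower.mulEquiv
  have he (g : Matrix.SpecialLinearGroup (Fin N) ℂ) :
      slTensorAct N (m + m') (n + n') g ∘ₗ e.toLinearMap =
        e.toLinearMap ∘ₗ TensorProduct.map (slTensorAct N m n g) (slTensorAct N m' n' g) := by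
    refine TensorProduct.ext_fourfold' fun a b c d => ?_
    simp only [e, slTensorAct, LinearMap.coe_comp, LinearEquiv.coe_coe, Function.comp_apply,
      LinearEquiv.trans_apply, TensorProduct.tensorTensorTensorComm_tmul,
      TensorProduct.congr_tmul, TensorProduct.map_tmul, TensorPower.map_mulEquiv]
  refine (Submodule.ne_bot_iff _).mpr ⟨e (x ⊗ₜ y), mem_slInvariants.mpr fun g => ?_, ?_⟩
  · have := LinearMap.congr_fun (he g) (x ⊗ₜ y)
    simpa [hx g, hy g] using this
  · exact e.map_ne_zero_iff.mpr (TensorProduct.tmul_ne_zero_of_ne_zero hx0 hy0)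

theorem tprod_isEmpty_ne_zero {K W : Type*} [Field K] [AddCommGroup W] [Module K W]
    (v : Fin 0 → W) : PiTensorProduct.tprod K v ≠ 0 := by
  intro h
  have := congrArg (PiTensorProduct.isEmptyEquiv (Fin 0)) h
  simp at this

theorem slInvariants_zero_zero_ne_bot (N : ℕ) : slInvariants N 0 0 ≠ ⊥ := by
  refine (Submodule.ne_bot_iff _).mpr
    ⟨PiTensorProduct.tprod ℂ 0 ⊗ₜ PiTensorProduct.tprod ℂ 0, mem_slInvariants.mpr fun g => ?_,
      TensorProduct.tmul_ne_zero_of_ne_zero (tprod_isEmpty_ne_zero _) (tprod_isEmpty_ne_zero _)⟩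
  simp only [slTensorAct, TensorProduct.map_tmul, PiTensorProduct.map_tprod]
  congr 2
  exact Subsingleton.elim _ _

theorem slInvariants_zero_self_ne_bot (N : ℕ) : slInvariants N 0 N ≠ ⊥ := by
  obtain ⟨x, hx0, hx⟩ := exists_tensorPower_ne_zero_forall_det_eq_one (Pi.basisFun ℂ (Fin N))
  refine (Submodule.ne_bot_iff _).mpr
    ⟨PiTensorProduct.tprod ℂ 0 ⊗ₜ x, mem_slInvariants.mpr fun g => ?_,
      TensorProduct.tmul_ne_zero_of_ne_zero (tprod_isEmpty_ne_zero _) hx0⟩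
  simp only [slTensorAct, TensorProduct.map_tmul, PiTensorProduct.map_tprod,
    hx _ (det_stdAct N g)]
  congr 2

theorem slInvariants_self_zero_ne_bot (N : ℕ) : slInvariants N N 0 ≠ ⊥ := by
  obtain ⟨x, hx0, hx⟩ :=
    exists_tensorPower_ne_zero_forall_det_eq_one (Pi.basisFun ℂ (Fin N)).dualBasis
  refine (Submodule.ne_bot_iff _).mpr
    ⟨x ⊗ₜ PiTensorProduct.tprod ℂ 0, mem_slInvariants.mpr fun g => ?_,
      TensorProduct.tmul_ne_zero_of_ne_zero hx0 (tprod_isEmpty_ne_zero _)⟩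
  simp only [slTensorAct, TensorProduct.map_tmul, PiTensorProduct.map_tprod,
    hx _ (det_dualAct N g)]
  congr 2
  exact Subsingleton.elim _ _

theorem dualTensorHom_map_dualAct_stdAct {N : ℕ} (g : Matrix.SpecialLinearGroup (Fin N) ℂ)
    (x : Module.Dual ℂ (Fin N → ℂ) ⊗[ℂ] (Fin N → ℂ)) :
    dualTensorHom ℂ _ _ (TensorProduct.map (dualAct N g) (stdAct N g) x) =
      stdAct N g ∘ₗ dualTensorHom ℂ _ _ x ∘ₗ stdAct N g⁻¹ := by
  induction x with
  | zero => simp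
  | add x y hx hy => simp only [map_add, hx, hy, LinearMap.add_comp, LinearMap.comp_add]
  | tmul φ v =>
    refine LinearMap.ext fun w => ?_
    simp only [TensorProduct.map_tmul, dualTensorHom_apply, LinearMap.comp_apply, map_smul]
    rfl

theorem stdAct_comp_stdAct_inv {N : ℕ} (g : Matrix.SpecialLinearGroup (Fin N) ℂ) :
    stdAct N g ∘ₗ stdAct N g⁻¹ = LinearMap.id := by
  rw [stdAct, stdAct, ← Matrix.toLin'_mul, ← Matrix.SpecialLinearGroup.coe_mul, mul_inv_cancel,
    Matrix.SpecialLinearGroup.coe_one, Matrix.toLin'_one]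

theorem stdAct_inv_comp_stdAct {N : ℕ} (g : Matrix.SpecialLinearGroup (Fin N) ℂ) :
    stdAct N g⁻¹ ∘ₗ stdAct N g = LinearMap.id := by
  simpa using stdAct_comp_stdAct_inv g⁻¹

/-- An endomorphism of `ℂ^N` commuting with `SL_N(ℂ)` is a scalar. -/
theorem mem_span_id_of_forall_stdAct_comm {N : ℕ} {f : (Fin N → ℂ) →ₗ[ℂ] (Fin N → ℂ)}
    (hf : ∀ g, stdAct N g ∘ₗ f = f ∘ₗ stdAct N g) : f ∈ ℂ ∙ LinearMap.id := by
  obtain ⟨c, hc⟩ : LinearMap.toMatrix' f ∈ Set.range (Matrix.scalar (Fin N)) := by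
    refine Matrix.mem_range_scalar_of_commute_transvectionStruct fun t => ?_
    have h := congrArg LinearMap.toMatrix' (hf ⟨t.toMatrix, t.det⟩)
    simp only [stdAct, LinearMap.toMatrix'_comp, LinearMap.toMatrix'_toLin'] at h
    exact h
  refine Submodule.mem_span_singleton.mpr ⟨c, ?_⟩
  apply LinearMap.toMatrix'.injective
  rw [← hc, map_smul, LinearMap.toMatrix'_id]
  exact Matrix.smul_one_eq_diagonal c

theorem iInf_eqLocus_dualAct_stdAct (N : ℕ) :
    (⨅ g : Matrix.SpecialLinearGroup (Fin N) ℂ,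
        LinearMap.eqLocus (TensorProduct.map (dualAct N g) (stdAct N g)) LinearMap.id) =
      ℂ ∙ (dualTensorHomEquiv ℂ (Fin N → ℂ) (Fin N → ℂ)).symm LinearMap.id := by
  have hinj : Function.Injective (dualTensorHom ℂ (Fin N → ℂ) (Fin N → ℂ)) :=
    (dualTensorHomEquiv ℂ (Fin N → ℂ) (Fin N → ℂ)).injective
  have hid : dualTensorHom ℂ (Fin N → ℂ) (Fin N → ℂ)
      ((dualTensorHomEquiv ℂ (Fin N → ℂ) (Fin N → ℂ)).symm LinearMap.id) = LinearMap.id :=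
    (dualTensorHomEquiv ℂ (Fin N → ℂ) (Fin N → ℂ)).apply_symm_apply _
  apply le_antisymm
  · intro x hx
    simp only [Submodule.mem_iInf, LinearMap.mem_eqLocus, LinearMap.id_apply] at hx
    have hcomm (g) : stdAct N g ∘ₗ dualTensorHom ℂ _ _ x = dualTensorHom ℂ _ _ x ∘ₗ stdAct N g := by
      conv_rhs => rw [← hx g, dualTensorHom_map_dualAct_stdAct, LinearMap.comp_assoc,
        LinearMap.comp_assoc, stdAct_inv_comp_stdAct, LinearMap.comp_id]
    obtain ⟨c, hc⟩ := Submodule.mem_span_singleton.mp (mem_span_id_of_forall_stdAct_comm hcomm)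
    refine Submodule.mem_span_singleton.mpr ⟨c, hinj ?_⟩
    rw [map_smul, hid, hc]
  · rw [Submodule.span_singleton_le_iff_mem]
    simp only [Submodule.mem_iInf, LinearMap.mem_eqLocus, LinearMap.id_apply]
    intro g
    apply hinj
    rw [dualTensorHom_map_dualAct_stdAct, hid, LinearMap.id_comp, stdAct_comp_stdAct_inv]

theorem finrank_iInf_eqLocus_dualAct_stdAct {N : ℕ} (hN : N ≠ 0) :
    Module.finrank ℂ
        ↥(⨅ g : Matrix.SpecialLinearGroup (Fin N) ℂ,
            LinearMap.eqLocus (TensorProduct.map (dualAct N g) (stdAct N g))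
              LinearMap.id) = 1 := by
  have : NeZero N := ⟨hN⟩
  rw [iInf_eqLocus_dualAct_stdAct]
  refine finrank_span_singleton ((LinearEquiv.map_ne_zero_iff _).mpr fun h => ?_)
  simpa using congrFun (LinearMap.congr_fun h (fun _ => 1)) 0

theorem slInvariants_one_one_ne_bot {N : ℕ} (hN : N ≠ 0) : slInvariants N 1 1 ≠ ⊥ := by
  have hne : (⨅ g : Matrix.SpecialLinearGroup (Fin N) ℂ,
      LinearMap.eqLocus (TensorProduct.map (dualAct N g) (stdAct N g)) LinearMap.id) ≠ ⊥ := by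
    intro h
    have h1 := finrank_iInf_eqLocus_dualAct_stdAct hN
    rw [h, finrank_bot] at h1
    exact zero_ne_one h1
  obtain ⟨x, hx, hx0⟩ := Submodule.exists_mem_ne_zero_of_ne_bot hne
  simp only [Submodule.mem_iInf, LinearMap.mem_eqLocus, LinearMap.id_apply] at hx
  let e : TensorSpace N 1 1 ≃ₗ[ℂ] Module.Dual ℂ (Fin N → ℂ) ⊗[ℂ] (Fin N → ℂ) :=
    TensorProduct.congr (PiTensorProduct.subsingletonEquiv 0) (PiTensorProduct.subsingletonEquiv 0)
  have he (g : Matrix.SpecialLinearGroup (Fin N) ℂ) :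
      e.toLinearMap ∘ₗ slTensorAct N 1 1 g =
        TensorProduct.map (dualAct N g) (stdAct N g) ∘ₗ e.toLinearMap := by
    refine TensorProduct.ext (PiTensorProduct.ext (MultilinearMap.ext fun v =>
      PiTensorProduct.ext (MultilinearMap.ext fun w => ?_)))
    simp [e, slTensorAct]
  refine (Submodule.ne_bot_iff _).mpr ⟨e.symm x, mem_slInvariants.mpr fun g => e.injective ?_,
    e.symm.map_ne_zero_iff.mpr hx0⟩
  simpa [hx g] using LinearMap.congr_fun (he g) (e.symm x)

theorem slInvariants_add_mul_ne_bot {N : ℕ} (hN : N ≠ 0) (a j k : ℕ) :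
    slInvariants N (a + N * j) (a + N * k) ≠ ⊥ := by
  have ha : slInvariants N a a ≠ ⊥ := by
    induction a with
    | zero => exact slInvariants_zero_zero_ne_bot N
    | succ a ih => exact slInvariants_add_ne_bot ih (slInvariants_one_one_ne_bot hN)
  have hj : slInvariants N (a + N * j) a ≠ ⊥ := by
    induction j with
    | zero => rwa [mul_zero, add_zero]
    | succ j ih =>
      have := slInvariants_add_ne_bot ih (slInvariants_self_zero_ne_bot N)
      rwa [add_zero, add_assoc, ← mul_add_one] at this
  induction k with
  | zero => rwa [mul_zero, add_zero]
  | succ k ih =>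
    have := slInvariants_add_ne_bot ih (slInvariants_zero_self_ne_bot N)
    rwa [add_zero, add_assoc a (N * k) N, ← mul_add_one] at this

/-- The scalar matrix of a primitive `N`-th root of unity acts on `(V^*)^{⊗m} ⊗ V^{⊗n}` by a
scalar, which is trivial only if `N` divides `m - n`. -/
theorem dvd_sub_of_slInvariants_ne_bot {N m n : ℕ} (hN : N ≠ 0) (h : slInvariants N m n ≠ ⊥) :
    (N : ℤ) ∣ (m : ℤ) - (n : ℤ) := by
  obtain ⟨x, hx, hx0⟩ := Submodule.exists_mem_ne_zero_of_ne_bot h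
  obtain ⟨ζ, hζ⟩ : ∃ ζ : ℂ, IsPrimitiveRoot ζ N := ⟨_, Complex.isPrimitiveRoot_exp N hN⟩
  have hζ0 : ζ ≠ 0 := hζ.ne_zero hN
  let g : Matrix.SpecialLinearGroup (Fin N) ℂ :=
    ⟨ζ⁻¹ • 1, by rw [Matrix.det_smul, Fintype.card_fin, inv_pow, hζ.pow_eq_one]; simp⟩
  let g' : Matrix.SpecialLinearGroup (Fin N) ℂ :=
    ⟨ζ • 1, by rw [Matrix.det_smul, Fintype.card_fin, hζ.pow_eq_one]; simp⟩
  have hginv : g⁻¹ = g' := by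
    refine inv_eq_of_mul_eq_one_right (Subtype.ext ?_)
    rw [Matrix.SpecialLinearGroup.coe_mul]
    simp [g, g', hζ0]
  have hstd : stdAct N g = ζ⁻¹ • LinearMap.id := by
    simp [stdAct, g]
  have hdual : dualAct N g = ζ • LinearMap.id := by
    rw [dualAct, hginv]
    ext φ v
    simp [g']
  have hfix := mem_slInvariants.mp hx g
  rw [slTensorAct, hstd, hdual, PiTensorProduct.map_smul_id, PiTensorProduct.map_smul_id,
    TensorProduct.map_smul_left, TensorProduct.map_smul_right, TensorProduct.map_id, smul_smul,
    Fintype.card_fin, Fintype.card_fin, LinearMap.smul_apply, LinearMap.id_apply] at hfix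
  have hone : ζ ^ m * ζ⁻¹ ^ n = 1 := by
    obtain ⟨φ, hφ⟩ : ∃ φ : Module.Dual ℂ (TensorSpace N m n), φ x ≠ 0 :=
      not_forall.mp ((Module.forall_dual_apply_eq_zero_iff ℂ x).not.mpr hx0)
    have := congrArg φ hfix
    rw [map_smul, smul_eq_mul] at this
    exact (mul_eq_right₀ hφ).mp this
  rw [← hζ.zpow_eq_one_iff_dvd, zpow_sub₀ hζ0, zpow_natCast, zpow_natCast, div_eq_mul_inv,
    ← inv_pow, hone]

theorem stmt_2 (N : ℕ) (hN : 2 ≤ N) :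
    Module.finrank ℂ
        ↥(⨅ g : Matrix.SpecialLinearGroup (Fin N) ℂ,
            LinearMap.eqLocus (TensorProduct.map (dualAct N g) (stdAct N g))
              LinearMap.id) = 1 ∧
      ∀ m n : ℕ, (m, n) ≠ (0, 0) →
        (slInvariants N m n ≠ ⊥ ↔ (N : ℤ) ∣ ((m : ℤ) - (n : ℤ))) := by
  have hN0 : N ≠ 0 := by lia
  refine ⟨finrank_iInf_eqLocus_dualAct_stdAct hN0, fun m n _ =>
    ⟨dvd_sub_of_slInvariants_ne_bot hN0, fun ⟨k, hk⟩ => ?_⟩⟩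
  obtain ⟨k, rfl | rfl⟩ := k.eq_nat_or_neg
  · obtain rfl : m = n + N * k := by zify; linarith
    simpa using slInvariants_add_mul_ne_bot hN0 n k 0
  · obtain rfl : n = m + N * k := by zify; linarith
    simpa using slInvariants_add_mul_ne_bot hN0 m 0 k
end

section
/- Let N ≥ 2 be an even integer and let Sp_N(ℂ) be the symplectic group of a fixed nondegenerate alternating bilinear form on V = ℂ^N, acting diagonally on tensor powers of V. Then the space of Sp_N(ℂ)-invariant vectors in V ⊗ V has dimension exactly 1, and for every integer m ≥ 1 the space of Sp_N(ℂ)-invariant vectors in V^{⊗m} is nonzero if and only if m is even. -/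
open TensorProduct Matrix

/-- The diagonal action of a matrix `g` on the `m`-th tensor power of `V = ℂ^N`. -/
noncomputable def tensorPowAct (N m : ℕ) (g : Matrix (Fin N) (Fin N) ℂ) :
    (PiTensorProduct ℂ fun _ : Fin m => (Fin N → ℂ)) →ₗ[ℂ]
      (PiTensorProduct ℂ fun _ : Fin m => (Fin N → ℂ)) :=
  PiTensorProduct.map fun _ => Matrix.toLin' g

/-- The space of invariant vectors in `V^{⊗m}` under the symplectic group of the
alternating form with Gram matrix `J`, i.e. under all `g` with `gᵀ J g = J`. -/
noncomputable def spInvariants (N : ℕ) (J : Matrix (Fin N) (Fin N) ℂ) (m : ℕ) :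
    Submodule ℂ (PiTensorProduct ℂ fun _ : Fin m => (Fin N → ℂ)) :=
  ⨅ g : {g : Matrix (Fin N) (Fin N) ℂ // gᵀ * J * g = J},
    LinearMap.eqLocus (tensorPowAct N m g.1) LinearMap.id

theorem Matrix.dotProduct_mulVec_self_of_transpose_eq_neg {n K : Type*} [Fintype n] [Field K]
    [NeZero (2 : K)] {J : Matrix n n K} (hJ : Jᵀ = -J) (v : n → K) : v ⬝ᵥ J *ᵥ v = 0 := by
  have h : v ⬝ᵥ J *ᵥ v = -(v ⬝ᵥ J *ᵥ v) := by
    conv_lhs => rw [dotProduct_mulVec, ← mulVec_transpose, hJ, dotProduct_comm, neg_mulVec,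
      dotProduct_neg]
  have h2 : (2 : K) * (v ⬝ᵥ J *ᵥ v) = 0 := by linear_combination h
  exact (mul_eq_zero.mp h2).resolve_left two_ne_zero

section SymplecticMatrices

variable {n K : Type*} [Fintype n] [DecidableEq n] [Field K] {J : Matrix n n K}

theorem Matrix.isUnit_of_transpose_mul_mul_eq (hJ : IsUnit J.det) {g : Matrix n n K}
    (hg : gᵀ * J * g = J) : IsUnit g.det := by
  rw [← hg, det_mul] at hJ
  exact isUnit_of_mul_isUnit_right hJ

/-- If `g` preserves the form with Gram matrix `J`, it preserves the inverse bivector. -/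
theorem Matrix.mul_inv_mul_transpose_eq (hJ : IsUnit J.det) {g : Matrix n n K}
    (hg : gᵀ * J * g = J) : g * J⁻¹ * gᵀ = J⁻¹ := by
  have hu := isUnit_of_transpose_mul_mul_eq hJ hg
  have hut : IsUnit gᵀ.det := by rwa [det_transpose]
  have h : J⁻¹ = g⁻¹ * J⁻¹ * gᵀ⁻¹ := by
    conv_lhs => rw [← hg]
    rw [Matrix.mul_inv_rev, Matrix.mul_inv_rev, Matrix.mul_assoc]
  rw [h, Matrix.mul_assoc, Matrix.mul_assoc, nonsing_inv_mul _ hut, Matrix.mul_one,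
    mul_nonsing_inv_cancel_left _ _ hu, ← h]

/-- The symplectic transvection along `v` preserves the form. -/
theorem Matrix.transvection_preserves [NeZero (2 : K)] (hJ : Jᵀ = -J) (v : n → K) :
    (1 + vecMulVec v v * J)ᵀ * J * (1 + vecMulVec v v * J) = J := by
  have h : vecMulVec v v * J * vecMulVec v v = 0 := by
    rw [Matrix.mul_assoc, mul_vecMulVec, vecMulVec_mul_vecMulVec,
      dotProduct_mulVec_self_of_transpose_eq_neg hJ, zero_smul, vecMulVec_zero]
  have h' : J * vecMulVec v v * J * (vecMulVec v v * J) = 0 := by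
    calc _ = J * (vecMulVec v v * J * vecMulVec v v) * J := by simp only [Matrix.mul_assoc]
      _ = 0 := by rw [h]; simp
  rw [transpose_add, transpose_one, transpose_mul, transpose_vecMulVec, hJ]
  simp only [Matrix.add_mul, Matrix.mul_add, Matrix.neg_mul, Matrix.one_mul, Matrix.mul_one, h']
  simp only [Matrix.mul_assoc]
  abel

/-- A matrix commuting with all symplectic transvections is scalar. -/
theorem Matrix.exists_eq_scalar_of_commute_transvections (hJ : IsUnit J.det) {A : Matrix n n K}
    (hA : ∀ v : n → K, A * (vecMulVec v v * J) = vecMulVec v v * J * A) :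
    ∃ c : K, A = c • (1 : Matrix n n K) := by
  have key : ∀ v : n → K, ¬ LinearIndependent K ![v, toLin' A v] := by
    intro v hli
    have hv : v ≠ 0 := hli.ne_zero 0
    have hw : v ᵥ* J ≠ 0 := fun h0 => hv <| by
      have h1 := congrArg (· ᵥ* J⁻¹) h0
      simpa [vecMul_vecMul, mul_nonsing_inv _ hJ] using h1
    obtain ⟨j, hj⟩ := Function.ne_iff.mp hw
    have h := hA v
    rw [← Matrix.mul_assoc, mul_vecMulVec, vecMulVec_mul, vecMulVec_mul, vecMulVec_mul] at h
    have hz := LinearIndependent.pair_iff.mp hli (-((v ᵥ* J) ᵥ* A) j) ((v ᵥ* J) j) <| by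
      ext i
      have hi := congrFun (congrFun h i) j
      simp only [vecMulVec_apply] at hi
      simp only [toLin'_apply, Pi.add_apply, Pi.smul_apply, smul_eq_mul, Pi.zero_apply]
      linear_combination hi
    exact hj hz.2
  obtain ⟨c, hc⟩ := (toLin' A).exists_eq_smul_id_of_forall_notLinearIndependent key
  refine ⟨c, toLin'.injective ?_⟩
  rw [hc, map_smul, toLin'_one, Module.End.one_eq_id]

/-- The matrices `M` with `g M gᵀ = M` for all symplectic `g` are the multiples of `J⁻¹`. -/
theorem Matrix.forall_mul_mul_transpose_eq_iff [NeZero (2 : K)] (hJalt : Jᵀ = -J)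
    (hJ : IsUnit J.det) (M : Matrix n n K) :
    (∀ g : Matrix n n K, gᵀ * J * g = J → g * M * gᵀ = M) ↔ ∃ c : K, c • J⁻¹ = M := by
  constructor
  · intro hM
    have hcomm : ∀ g : Matrix n n K, gᵀ * J * g = J → M * J * g = g * (M * J) := by
      intro g hg
      calc M * J * g = g * M * gᵀ * J * g := by rw [hM g hg]
        _ = g * M * (gᵀ * J * g) := by simp only [Matrix.mul_assoc]
        _ = g * (M * J) := by rw [hg, Matrix.mul_assoc]
    obtain ⟨c, hc⟩ := exists_eq_scalar_of_commute_transvections (A := M * J) hJ fun v => by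
      have h := hcomm _ (transvection_preserves hJalt v)
      rw [Matrix.mul_add, Matrix.add_mul, Matrix.mul_one, Matrix.one_mul] at h
      exact add_left_cancel h
    refine ⟨c, ?_⟩
    rw [← mul_nonsing_inv_cancel_right (A := J) M hJ, hc, smul_mul, Matrix.one_mul]
  · rintro ⟨c, rfl⟩ g hg
    rw [Matrix.mul_smul, Matrix.smul_mul, mul_inv_mul_transpose_eq hJ hg]

end SymplecticMatrices

/-- A tensor in `V ⊗ V`, viewed as the matrix of its coordinates. -/
noncomputable def tensorToMatrix (n K : Type*) [Fintype n] [DecidableEq n] [Field K] :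
    ((n → K) ⊗[K] (n → K)) ≃ₗ[K] Matrix n n K :=
  ((Pi.basisFun K n).tensorProduct (Pi.basisFun K n)).equivFun ≪≫ₗ
    LinearEquiv.curry K K n n ≪≫ₗ Matrix.ofLinearEquiv K

theorem tensorToMatrix_tmul {n K : Type*} [Fintype n] [DecidableEq n] [Field K] (x y : n → K) :
    tensorToMatrix n K (x ⊗ₜ y) = vecMulVec x y := by
  ext i j
  simp [tensorToMatrix, vecMulVec_apply, mul_comm]

theorem tensorToMatrix_map {n K : Type*} [Fintype n] [DecidableEq n] [Field K]
    (g : Matrix n n K) (t : (n → K) ⊗[K] (n → K)) :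
    tensorToMatrix n K (TensorProduct.map (toLin' g) (toLin' g) t) =
      g * tensorToMatrix n K t * gᵀ := by
  induction t using TensorProduct.induction_on with
  | zero => simp
  | tmul x y =>
    simp [tensorToMatrix_tmul, mul_vecMulVec, vecMulVec_mul, vecMul_transpose]
  | add x y hx hy => simp [hx, hy, Matrix.mul_add, Matrix.add_mul]

/-- The tensor obtained by placing the bivector with coordinates `M` in each of the pairs of
positions matched by `e`. -/
noncomputable def pairingTensor {N m r : ℕ} (e : Fin r ⊕ Fin r ≃ Fin m)
    (M : Matrix (Fin N) (Fin N) ℂ) : PiTensorProduct ℂ fun _ : Fin m => (Fin N → ℂ) :=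
  ∑ f : Fin r → Fin N × Fin N, (∏ i, M (f i).1 (f i).2) •
    PiTensorProduct.tprod ℂ fun j => Pi.single
      (Sum.elim (fun i => (f i).1) (fun i => (f i).2) (e.symm j)) (1 : ℂ)

theorem repr_tensorPowAct_pairingTensor {N m r : ℕ} (e : Fin r ⊕ Fin r ≃ Fin m)
    (M g : Matrix (Fin N) (Fin N) ℂ) (p : Fin m → Fin N) :
    (Basis.piTensorProduct fun _ : Fin m => Pi.basisFun ℂ (Fin N)).repr
        (tensorPowAct N m g (pairingTensor e M)) p =
      ∏ i, (g * M * gᵀ) (p (e (Sum.inl i))) (p (e (Sum.inr i))) := by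
  simp only [pairingTensor, tensorPowAct, map_sum, map_smul, PiTensorProduct.map_tprod,
    Finsupp.coe_finsetSum, Finset.sum_apply, Finsupp.smul_apply,
    Basis.piTensorProduct_repr_tprod_apply, Pi.basisFun_repr, toLin'_apply, mulVec_single_one,
    col_apply, smul_eq_mul]
  simp only [← Equiv.prod_comp e, Fintype.prod_sum_type, Equiv.symm_apply_apply, Sum.elim_inl,
    Sum.elim_inr, ← Finset.prod_mul_distrib]
  rw [← Fintype.prod_sum fun i (x : Fin N × Fin N) =>
    M x.1 x.2 * (g (p (e (Sum.inl i))) x.1 * g (p (e (Sum.inr i))) x.2)]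
  refine Finset.prod_congr rfl fun i _ => ?_
  simp only [mul_apply, transpose_apply, Finset.sum_mul, Fintype.sum_prod_type]
  rw [Finset.sum_comm]
  exact Finset.sum_congr rfl fun a _ => Finset.sum_congr rfl fun b _ => by ring

theorem mem_spInvariants {N m : ℕ} {J : Matrix (Fin N) (Fin N) ℂ}
    {t : PiTensorProduct ℂ fun _ : Fin m => (Fin N → ℂ)} :
    t ∈ spInvariants N J m ↔
      ∀ g : Matrix (Fin N) (Fin N) ℂ, gᵀ * J * g = J → tensorPowAct N m g t = t := by
  simp [spInvariants, Submodule.mem_iInf, LinearMap.mem_eqLocus]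

theorem tensorPowAct_one {N m : ℕ} (t : PiTensorProduct ℂ fun _ : Fin m => (Fin N → ℂ)) :
    tensorPowAct N m 1 t = t := by
  simp [tensorPowAct, toLin'_one, PiTensorProduct.map_id]

theorem tensorPowAct_neg_one {N m : ℕ} (t : PiTensorProduct ℂ fun _ : Fin m => (Fin N → ℂ)) :
    tensorPowAct N m (-1) t = (-1 : ℂ) ^ m • t := by
  induction t using PiTensorProduct.induction_on with
  | smul_tprod c x =>
    have h := (PiTensorProduct.tprod ℂ).map_smul_univ (fun _ : Fin m => (-1 : ℂ)) x
    simp only [neg_smul, one_smul, Finset.prod_const, Finset.card_univ, Fintype.card_fin] at h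
    rw [map_smul, tensorPowAct, PiTensorProduct.map_tprod, smul_comm, ← h]
    simp
  | add x y hx hy => rw [map_add, hx, hy, smul_add]

theorem spInvariants_eq_bot_of_odd {N m : ℕ} (J : Matrix (Fin N) (Fin N) ℂ) (hm : Odd m) :
    spInvariants N J m = ⊥ := by
  refine (Submodule.eq_bot_iff _).mpr fun t ht => ?_
  have h := mem_spInvariants.mp ht (-1) (by simp)
  rw [tensorPowAct_neg_one, hm.neg_one_pow] at h
  have h2 : (2 : ℂ) • t = 0 := by
    rw [two_smul]
    nth_rw 2 [← h]
    rw [← one_smul ℂ t, smul_smul, ← add_smul]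
    simp
  exact (smul_eq_zero.mp h2).resolve_left two_ne_zero

theorem pairingTensor_inv_mem_spInvariants {N m r : ℕ} (e : Fin r ⊕ Fin r ≃ Fin m)
    {J : Matrix (Fin N) (Fin N) ℂ} (hJ : IsUnit J.det) :
    pairingTensor e J⁻¹ ∈ spInvariants N J m := by
  refine mem_spInvariants.mpr fun g hg => ?_
  conv_rhs => rw [← tensorPowAct_one (pairingTensor e J⁻¹)]
  refine (Basis.piTensorProduct fun _ : Fin m => Pi.basisFun ℂ (Fin N)).repr.injective
    (Finsupp.ext fun p => ?_)
  simp only [repr_tensorPowAct_pairingTensor, mul_inv_mul_transpose_eq hJ hg, Matrix.one_mul,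
    transpose_one, Matrix.mul_one]

theorem pairingTensor_ne_zero {N m r : ℕ} (e : Fin r ⊕ Fin r ≃ Fin m)
    {M : Matrix (Fin N) (Fin N) ℂ} (hM : M ≠ 0) : pairingTensor e M ≠ 0 := by
  obtain ⟨a, b, hab⟩ : ∃ a b, M a b ≠ 0 := by
    by_contra! h
    exact hM (Matrix.ext h)
  intro h0
  have h := repr_tensorPowAct_pairingTensor e M 1
    fun j => Sum.elim (fun _ => a) (fun _ => b) (e.symm j)
  rw [h0] at h
  simp only [map_zero, Finsupp.coe_zero, Pi.zero_apply, Matrix.one_mul, transpose_one,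
    Matrix.mul_one, Equiv.symm_apply_apply, Sum.elim_inl, Sum.elim_inr] at h
  exact Finset.prod_ne_zero_iff.mpr (fun _ _ => hab) h.symm

theorem stmt_3 (N : ℕ) (hN : 2 ≤ N) (hNeven : Even N)
    (J : Matrix (Fin N) (Fin N) ℂ) (hJalt : Jᵀ = -J) (hJnd : IsUnit J.det) :
    Module.finrank ℂ
        ↥(⨅ g : {g : Matrix (Fin N) (Fin N) ℂ // gᵀ * J * g = J},
            LinearMap.eqLocus
              (TensorProduct.map (Matrix.toLin' g.1) (Matrix.toLin' g.1))
              LinearMap.id) = 1 ∧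
      ∀ m : ℕ, 1 ≤ m → (spInvariants N J m ≠ ⊥ ↔ Even m) := by
  have : Nonempty (Fin N) := ⟨⟨0, by omega⟩⟩
  have hJinv : J⁻¹ ≠ 0 := fun h => by
    have h1 := mul_nonsing_inv J hJnd
    rw [h, Matrix.mul_zero] at h1
    exact zero_ne_one h1
  have hspan : (⨅ g : {g : Matrix (Fin N) (Fin N) ℂ // gᵀ * J * g = J},
      LinearMap.eqLocus (TensorProduct.map (toLin' g.1) (toLin' g.1)) LinearMap.id) =
      Submodule.span ℂ {(tensorToMatrix (Fin N) ℂ).symm J⁻¹} := by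
    ext t
    simp only [Submodule.mem_iInf, LinearMap.mem_eqLocus, Subtype.forall, LinearMap.id_apply,
      Submodule.mem_span_singleton]
    simp only [← (tensorToMatrix (Fin N) ℂ).injective.eq_iff, tensorToMatrix_map, map_smul,
      LinearEquiv.apply_symm_apply]
    exact forall_mul_mul_transpose_eq_iff hJalt hJnd _
  refine ⟨?_, fun m _ => ⟨fun h => ?_, ?_⟩⟩
  · rw [hspan]
    exact finrank_span_singleton ((tensorToMatrix (Fin N) ℂ).symm.map_ne_zero_iff.mpr hJinv)
  · by_contra hm
    exact h (spInvariants_eq_bot_of_odd J (Nat.not_even_iff_odd.mp hm))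
  · rintro ⟨r, rfl⟩
    exact (Submodule.ne_bot_iff _).mpr ⟨_, pairingTensor_inv_mem_spInvariants finSumFinEquiv hJnd,
      pairingTensor_ne_zero _ hJinv⟩
end

section
/- Let κ, λ ≥ 1 be integers with ν = κ + λ even. Call a pair (σ, e), with σ ∈ P(ν, ν/2) and e = (e_1,…,e_ν) ∈ {+1,−1}^ν, focusing if for every u ∈ {1,…,ν/2} there is exactly one index j ∈ {1,…,κ} with σ(j) = u, exactly one index ℓ ∈ {κ+1,…,ν} with σ(ℓ) = u, u has no other preimages under σ, and these two indices carry opposite signs, i.e. e_j = −e_ℓ. Then the number of focusing pairs equals κ!·2^κ if κ = λ, and equals 0 if κ ≠ λ. -/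
/-- The set `P(t,s)` of surjective maps `σ : {1,…,t} → {1,…,s}` (here realized as
`Fin t → Fin s`, zero-indexed) such that for every `j`, either `σ j` is the first
element or there is some `k < j` with `σ j = σ k + 1`. -/
def IsPmap (t s : ℕ) (σ : Fin t → Fin s) : Prop :=
  Function.Surjective σ ∧
    ∀ j : Fin t, (σ j : ℕ) = 0 ∨ ∃ k : Fin t, k < j ∧ (σ j : ℕ) = (σ k : ℕ) + 1

/-- An injective self-map of `Fin n` satisfying the growth condition of `IsPmap` is the identity. -/
theorem eq_self_of_injective_of_growth {n : ℕ} {f : Fin n → Fin n} (hf : Function.Injective f)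
    (hg : ∀ j, (f j : ℕ) = 0 ∨ ∃ k < j, (f j : ℕ) = (f k : ℕ) + 1) (j : Fin n) : f j = j := by
  induction j using WellFoundedLT.induction with
  | _ j ih =>
    have hle : (f j : ℕ) ≤ j := by
      obtain h | ⟨k, hk, h⟩ := hg j
      · omega
      · rw [ih k hk] at h
        have := Fin.lt_def.1 hk
        omega
    rcases (Fin.le_def.2 hle).lt_or_eq with h | h
    · exact hf (ih _ h)
    · exact h

/-- The pairs of a map to blocks and a choice of signs in which every block has exactly one index
below `κ` and one index from `κ` on, of opposite signs. -/
def IsFocusing (κ lam s : ℕ) (pe : (Fin (κ + lam) → Fin s) × (Fin (κ + lam) → ℤ)) : Prop :=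
  IsPmap (κ + lam) s pe.1 ∧ (∀ j, pe.2 j = 1 ∨ pe.2 j = -1) ∧
    ∀ u : Fin s, ∃ j l : Fin (κ + lam), (j : ℕ) < κ ∧ κ ≤ (l : ℕ) ∧
      pe.1 j = u ∧ pe.1 l = u ∧ pe.2 j = -pe.2 l ∧
      ∀ i : Fin (κ + lam), pe.1 i = u → i = j ∨ i = l

theorem IsFocusing.le {κ lam s : ℕ} {pe : (Fin (κ + lam) → Fin s) × (Fin (κ + lam) → ℤ)}
    (h : IsFocusing κ lam s pe) : s ≤ κ ∧ s ≤ lam := by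
  choose j l hj hl hσj hσl _ _ using h.2.2
  constructor
  · have hinj : Function.Injective fun u => (⟨j u, hj u⟩ : Fin κ) := fun u v huv => by
      have : j u = j v := Fin.ext (by simpa using huv)
      rw [← hσj u, this, hσj]
    simpa using Fintype.card_le_of_injective _ hinj
  · have hinj : Function.Injective fun u => (⟨l u - κ, by have := hl u; omega⟩ : Fin lam) :=
      fun u v huv => by
        have huv' : (l u : ℕ) - κ = l v - κ := by simpa using huv
        have : l u = l v := Fin.ext (by have := hl u; have := hl v; omega)
        rw [← hσl u, this, hσl]
    simpa using Fintype.card_le_of_injective _ hinj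

/-- The sign `1` or `-1` encoded by a Boolean. -/
def boolSign (b : Bool) : ℤ := if b then 1 else -1

theorem boolSign_injective : Function.Injective boolSign := by decide

theorem boolSign_eq_one_or (b : Bool) : boolSign b = 1 ∨ boolSign b = -1 := by
  cases b <;> simp [boolSign]

/-- The focusing pair that is the identity on the first half, a given permutation on the second
half, and carries given signs on the first half. -/
def focusingPair {n : ℕ} (x : Equiv.Perm (Fin n) × (Fin n → Bool)) :
    (Fin (n + n) → Fin n) × (Fin (n + n) → ℤ) :=
  (Fin.append id x.1, Fin.append (fun i => boolSign (x.2 i)) fun i => -boolSign (x.2 (x.1 i)))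

theorem isFocusing_focusingPair {n : ℕ} (x : Equiv.Perm (Fin n) × (Fin n → Bool)) :
    IsFocusing n n n (focusingPair x) := by
  obtain ⟨π, b⟩ := x
  refine ⟨⟨fun u => ⟨Fin.castAdd n u, by simp [focusingPair]⟩, fun j => ?_⟩, fun j => ?_,
    fun u => ⟨Fin.castAdd n u, Fin.natAdd n (π.symm u), by simp, by simp, ?_, ?_, ?_,
      fun i => ?_⟩⟩
  · have key (u : Fin n) (hu : u.castAdd n ≤ j) (h0 : (u : ℕ) ≠ 0) : ∃ k : Fin (n + n), k < j ∧
        (u : ℕ) = ((focusingPair (π, b)).1 k : ℕ) + 1 := by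
      refine ⟨Fin.castAdd n ⟨u - 1, by omega⟩, ?_, ?_⟩
      · rw [Fin.le_def] at hu
        rw [Fin.lt_def]
        simp at hu ⊢
        omega
      · simp only [focusingPair, Fin.append_left, id_eq]
        omega
    refine or_iff_not_imp_left.2 (key _ ?_)
    induction j using Fin.addCases with
    | left i => simp [focusingPair]
    | right i =>
      rw [Fin.le_def]
      simp [-Fin.natAdd_eq_addNat, focusingPair]
      omega
  · induction j using Fin.addCases with
    | left i => simpa [focusingPair] using boolSign_eq_one_or (b i)
    | right i =>
      have := boolSign_eq_one_or (b (π i))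
      simp only [focusingPair, Fin.append_right]
      omega
  · simp [focusingPair]
  · simp [-Fin.natAdd_eq_addNat, focusingPair]
  · simp [-Fin.natAdd_eq_addNat, focusingPair]
  · induction i using Fin.addCases with
    | left i => rintro rfl; simp [focusingPair]
    | right i => rintro rfl; simp [-Fin.natAdd_eq_addNat, focusingPair]

theorem focusingPair_injective {n : ℕ} : Function.Injective (focusingPair (n := n)) := by
  rintro ⟨π, b⟩ ⟨π', b'⟩ h
  simp only [focusingPair, Prod.mk.injEq] at h
  refine Prod.ext (Equiv.ext fun i => ?_) (funext fun i => boolSign_injective ?_)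
  · simpa [-Fin.natAdd_eq_addNat] using congrFun h.1 (Fin.natAdd n i)
  · simpa using congrFun h.2 (Fin.castAdd n i)

theorem IsFocusing.exists_focusingPair_eq {n : ℕ}
    {pe : (Fin (n + n) → Fin n) × (Fin (n + n) → ℤ)} (h : IsFocusing n n n pe) :
    ∃ x, focusingPair x = pe := by
  obtain ⟨σ, e⟩ := pe
  obtain ⟨⟨-, hg⟩, he, hu⟩ := h
  dsimp only at hg he hu
  have hleft : ∀ i, σ (Fin.castAdd n i) = i := by
    refine eq_self_of_injective_of_growth (f := fun i => σ (Fin.castAdd n i)) ?_ fun j => ?_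
    · intro i i' hii
      obtain ⟨j, l, hj, hl, -, -, -, huniq⟩ := hu (σ (Fin.castAdd n i))
      have h1 := huniq _ rfl
      have h2 := huniq _ hii.symm
      simp only [Fin.ext_iff, Fin.val_castAdd] at h1 h2 ⊢
      omega
    · refine (hg (Fin.castAdd n j)).imp_right ?_
      rintro ⟨k, hk, hσ⟩
      have hk' : (k : ℕ) < j := by simpa [Fin.lt_def] using hk
      exact ⟨⟨k, by omega⟩, hk', hσ⟩
  have hright : Function.Surjective fun i => σ (Fin.natAdd n i) := fun u => by
    obtain ⟨j, l, hj, hl, -, hσl, -, -⟩ := hu u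
    refine ⟨⟨l - n, by omega⟩, ?_⟩
    rw [← hσl]
    exact congrArg σ (Fin.ext (by simp; omega))
  have hsign (i : Fin n) : e (Fin.natAdd n i) = -e (Fin.castAdd n (σ (Fin.natAdd n i))) := by
    obtain ⟨j, l, hj, hl, -, -, hjl, huniq⟩ := hu (σ (Fin.natAdd n i))
    have h1 : Fin.natAdd n i = l := (huniq _ rfl).resolve_left fun h => by
      simp only [Fin.ext_iff, Fin.val_natAdd] at h
      omega
    have h2 : Fin.castAdd n (σ (Fin.natAdd n i)) = j :=
      (huniq _ (hleft _)).resolve_right fun h => by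
        simp only [Fin.ext_iff, Fin.val_castAdd] at h
        omega
    rw [h2, h1, hjl, neg_neg]
  have hdec (i : Fin n) : boolSign (decide (e (Fin.castAdd n i) = 1)) = e (Fin.castAdd n i) := by
    rcases he (Fin.castAdd n i) with h | h <;> simp [h, boolSign]
  refine ⟨(Equiv.ofBijective _ (Finite.injective_iff_bijective.1
    (Finite.injective_iff_surjective.2 hright)), fun i => decide (e (Fin.castAdd n i) = 1)), ?_⟩
  refine Prod.ext (funext fun j => ?_) (funext fun j => ?_)
  · induction j using Fin.addCases with
    | left i => simp [focusingPair, hleft]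
    | right i => simp [-Fin.natAdd_eq_addNat, focusingPair]
  · induction j using Fin.addCases with
    | left i => simp [focusingPair, hdec]
    | right i => simp [-Fin.natAdd_eq_addNat, focusingPair, hdec, hsign i]

theorem card_isFocusing (n : ℕ) : Nat.card {pe // IsFocusing n n n pe} = n.factorial * 2 ^ n := by
  have hbij : Function.Bijective fun x : Equiv.Perm (Fin n) × (Fin n → Bool) =>
      (⟨focusingPair x, isFocusing_focusingPair x⟩ : {pe // IsFocusing n n n pe}) := by
    refine ⟨fun x y hxy => focusingPair_injective (congrArg Subtype.val hxy), fun ⟨pe, h⟩ => ?_⟩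
    obtain ⟨x, hx⟩ := h.exists_focusingPair_eq
    exact ⟨x, Subtype.ext hx⟩
  rw [← Nat.card_eq_of_bijective _ hbij]
  simp [Fintype.card_perm]

theorem stmt_11 (κ lam : ℕ) (hκ : 1 ≤ κ) (hlam : 1 ≤ lam) (heven : Even (κ + lam)) :
    Nat.card {pe : (Fin (κ + lam) → Fin ((κ + lam) / 2)) × (Fin (κ + lam) → ℤ) //
        IsPmap (κ + lam) ((κ + lam) / 2) pe.1 ∧ (∀ j, pe.2 j = 1 ∨ pe.2 j = -1) ∧
        ∀ u : Fin ((κ + lam) / 2),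
          ∃ j l : Fin (κ + lam), (j : ℕ) < κ ∧ κ ≤ (l : ℕ) ∧
            pe.1 j = u ∧ pe.1 l = u ∧ pe.2 j = -pe.2 l ∧
            ∀ i : Fin (κ + lam), pe.1 i = u → i = j ∨ i = l} =
      if κ = lam then Nat.factorial κ * 2 ^ κ else 0 := by
  change Nat.card {pe // IsFocusing κ lam ((κ + lam) / 2) pe} = _
  obtain ⟨s, hs⟩ := heven
  have hdiv : (κ + lam) / 2 = s := by omega
  rw [hdiv]
  split_ifs with h
  · obtain rfl : s = κ := by omega
    subst h
    exact card_isFocusing s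
  · have : IsEmpty {pe // IsFocusing κ lam s pe} := ⟨fun ⟨_, hpe⟩ => h (by
      have := hpe.le
      omega)⟩
    exact Nat.card_of_isEmpty
end

section
/- Let (X_n)_{n≥1} be a sequence of complex-valued random variables, each having finite absolute moments of all orders, and let σ > 0 be a real number. Assume that for all nonnegative integers κ and λ, the mixed moment E[X_n^κ · conj(X_n)^λ] converges, as n → ∞, to 2^κ·κ!·σ^κ if κ = λ and to 0 if κ ≠ λ. Then X_n converges in distribution to the complex random variable A + iB, where A and B are independent real centered Gaussian random variables each of variance σ (i.e. to the Gaussian vector on ℝ² with covariance matrix σ times the identity). -/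
open MeasureTheory Filter ProbabilityTheory

open scoped Nat

theorem norm_cexp_mul_sub_sum_le {w : ℂ} (hw : ‖w‖ = 1) (hre : w.re = 0) (n : ℕ) {y : ℝ}
    (hy : 0 ≤ y) :
    ‖Complex.exp (y * w) - ∑ k ∈ Finset.range n, (y * w) ^ k / (k ! : ℂ)‖ ≤ y ^ n / n ! := by
  induction n generalizing y with
  | zero => simp [Complex.norm_exp, hre]
  | succ n ih =>
    have hline (x : ℝ) : HasDerivAt (fun u : ℝ => (u : ℂ) * w) w x := by
      simpa using (Complex.ofRealCLM.hasDerivAt (x := x)).mul_const w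
    have hderiv (x : ℝ) : HasDerivAt
        (fun u : ℝ => Complex.exp (u * w) -
          ∑ k ∈ Finset.range (n + 1), (u * w) ^ k / (k ! : ℂ))
        (w * (Complex.exp (x * w) - ∑ k ∈ Finset.range n, (x * w) ^ k / (k ! : ℂ))) x := by
      simp_rw [Finset.sum_range_succ' _ n, pow_zero]
      have hsum : HasDerivAt
          (fun u : ℝ => ∑ k ∈ Finset.range n, (u * w) ^ (k + 1) / ((k + 1)! : ℂ))
          (∑ k ∈ Finset.range n, w * ((x * w) ^ k / (k ! : ℂ))) x := by
        refine HasDerivAt.fun_sum fun k _ => ?_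
        refine (((hline x).pow (k + 1)).div_const _).congr_deriv ?_
        have : (k ! : ℂ) ≠ 0 := by exact_mod_cast k.factorial_ne_zero
        have : (k + 1 : ℂ) ≠ 0 := by exact_mod_cast k.succ_ne_zero
        rw [Nat.factorial_succ]
        push_cast
        field_simp
      refine ((hline x).cexp.fun_sub (hsum.add_const _)).congr_deriv ?_
      rw [← Finset.mul_sum]
      ring
    have hbound (x : ℝ) : HasDerivAt (fun u : ℝ => u ^ (n + 1) / ((n + 1)! : ℝ))
        (x ^ n / n !) x := by
      refine (((hasDerivAt_id x).pow (n + 1)).div_const _).congr_deriv ?_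
      have : (n ! : ℝ) ≠ 0 := by exact_mod_cast n.factorial_ne_zero
      rw [Nat.factorial_succ]
      push_cast
      simp only [id]
      field_simp
    refine image_norm_le_of_norm_deriv_right_le_deriv_boundary
      (a := 0) (b := y) (fun x _ => (hderiv x).continuousAt.continuousWithinAt)
      (fun x _ => (hderiv x).hasDerivWithinAt) ?_ hbound
      (fun x hx => ?_) (Set.right_mem_Icc.2 hy)
    · simp [Finset.sum_range_succ']
    · rw [norm_mul, hw, one_mul]
      exact ih hx.1

theorem norm_cexp_mul_I_sub_sum_le (y : ℝ) (n : ℕ) :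
    ‖Complex.exp (y * Complex.I) - ∑ k ∈ Finset.range n, (y * Complex.I) ^ k / (k ! : ℂ)‖
      ≤ |y| ^ n / n ! := by
  rcases le_total 0 y with hy | hy
  · rw [abs_of_nonneg hy]
    exact norm_cexp_mul_sub_sum_le (by simp) (by simp) n hy
  · rw [abs_of_nonpos hy]
    simpa using norm_cexp_mul_sub_sum_le (w := -Complex.I) (by simp) (by simp) n (neg_nonneg.2 hy)

theorem norm_integral_cexp_sub_sum_moments_le {Ω : Type*} [MeasurableSpace Ω] {μ : Measure Ω}
    [IsProbabilityMeasure μ] {Y : Ω → ℝ} (hY : Measurable Y)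
    (hint : ∀ k : ℕ, Integrable (fun ω => Y ω ^ k) μ) (m : ℕ) :
    ‖∫ ω, Complex.exp (Y ω * Complex.I) ∂μ -
        ∑ k ∈ Finset.range (2 * m), Complex.I ^ k / (k ! : ℂ) * ∫ ω, (Y ω : ℂ) ^ k ∂μ‖
      ≤ ‖∫ ω, (Y ω : ℂ) ^ (2 * m) ∂μ‖ / (2 * m)! := by
  have hintc (k : ℕ) : Integrable (fun ω => (Y ω : ℂ) ^ k) μ := by
    simpa using (hint k).ofReal (𝕜 := ℂ)
  have hexp : Integrable (fun ω => Complex.exp (Y ω * Complex.I)) μ :=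
    Integrable.of_bound (by fun_prop) 1 (.of_forall fun ω => by simp [Complex.norm_exp])
  have hmoment : ‖∫ ω, (Y ω : ℂ) ^ (2 * m) ∂μ‖ = ∫ ω, |Y ω| ^ (2 * m) ∂μ := by
    have : ∀ ω, |Y ω| ^ (2 * m) = Y ω ^ (2 * m) := fun ω => (even_two_mul m).pow_abs _
    simp_rw [this, ← Complex.ofReal_pow]
    rw [integral_complex_ofReal, Complex.norm_real, Real.norm_of_nonneg]
    exact integral_nonneg fun ω => (even_two_mul m).pow_nonneg _
  have hsplit : ∫ ω, Complex.exp (Y ω * Complex.I) ∂μ -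
        ∑ k ∈ Finset.range (2 * m), Complex.I ^ k / (k ! : ℂ) * ∫ ω, (Y ω : ℂ) ^ k ∂μ =
      ∫ ω, (Complex.exp (Y ω * Complex.I) -
        ∑ k ∈ Finset.range (2 * m), (Y ω * Complex.I) ^ k / (k ! : ℂ)) ∂μ := by
    have hterm (ω : Ω) (k : ℕ) : (Y ω * Complex.I) ^ k / (k ! : ℂ) =
        Complex.I ^ k / (k ! : ℂ) * (Y ω : ℂ) ^ k := by
      rw [mul_pow]; ring
    simp_rw [hterm]
    rw [integral_sub hexp (integrable_finsetSum _ fun k _ => (hintc k).const_mul _),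
      integral_finsetSum _ fun k _ => (hintc k).const_mul _]
    simp_rw [integral_const_mul]
  rw [hsplit, hmoment, ← integral_div]
  refine norm_integral_le_of_norm_le ?_ (.of_forall fun ω => norm_cexp_mul_I_sub_sum_le _ _)
  exact (by simpa using (hint (2 * m)).abs : Integrable (fun ω => |Y ω| ^ (2 * m)) μ).div_const _

/-- Moments converging to a sequence whose exponential generating function at `I` has partial sums
tending to `L`, with negligible even terms, force the characteristic function at `1` to tend
to `L`. -/
theorem tendsto_integral_cexp_of_tendsto_moments {Ω : ℕ → Type*} [∀ n, MeasurableSpace (Ω n)]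
    {μ : ∀ n, Measure (Ω n)} [∀ n, IsProbabilityMeasure (μ n)] {Y : ∀ n, Ω n → ℝ}
    (hY : ∀ n, Measurable (Y n)) (hint : ∀ n k : ℕ, Integrable (fun ω => Y n ω ^ k) (μ n))
    {M : ℕ → ℂ} (hM : ∀ k, Tendsto (fun n => ∫ ω, (Y n ω : ℂ) ^ k ∂(μ n)) atTop (nhds (M k)))
    (hsmall : Tendsto (fun m => ‖M (2 * m)‖ / (2 * m)!) atTop (nhds 0)) {L : ℂ}
    (hL : Tendsto (fun m => ∑ k ∈ Finset.range (2 * m), Complex.I ^ k / (k ! : ℂ) * M k)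
      atTop (nhds L)) :
    Tendsto (fun n => ∫ ω, Complex.exp (Y n ω * Complex.I) ∂(μ n)) atTop (nhds L) := by
  rw [Metric.tendsto_atTop']
  intro ε hε
  obtain ⟨m, hm₁, hm₂⟩ := ((hsmall.eventually_lt_const (by positivity : 0 < ε / 3)).and
    (hL.eventually (Metric.ball_mem_nhds L (by positivity : 0 < ε / 3)))).exists
  have hsum : Tendsto (fun n => ∑ k ∈ Finset.range (2 * m),
      Complex.I ^ k / (k ! : ℂ) * ∫ ω, (Y n ω : ℂ) ^ k ∂(μ n)) atTop
      (nhds (∑ k ∈ Finset.range (2 * m), Complex.I ^ k / (k ! : ℂ) * M k)) :=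
    tendsto_finsetSum _ fun k _ => (hM k).const_mul _
  have hrem : Tendsto (fun n => ‖∫ ω, (Y n ω : ℂ) ^ (2 * m) ∂(μ n)‖ / (2 * m)!) atTop
      (nhds (‖M (2 * m)‖ / (2 * m)!)) := (hM _).norm.div_const _
  obtain ⟨N, hN⟩ := eventually_atTop.1 ((hrem.eventually_lt_const hm₁).and
    (hsum.eventually (Metric.ball_mem_nhds _ (by positivity : 0 < ε / 3))))
  refine ⟨N, fun n hn => ?_⟩
  obtain ⟨h₁, h₂⟩ := hN n hn.le
  have h₃ := norm_integral_cexp_sub_sum_moments_le (hY n) (hint n) m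
  rw [← dist_eq_norm] at h₃
  refine (dist_triangle4 _ _ _ _).trans_lt
    ((add_lt_add (add_lt_add (h₃.trans_lt h₁) h₂) hm₂).trans_eq ?_)
  ring

/-- The moments of a centered real Gaussian variable of variance `2 * s`. -/
noncomputable def gaussianMoment (s : ℝ) (k : ℕ) : ℂ :=
  if Even k then (k ! : ℂ) / ((k / 2)! : ℂ) * (s : ℂ) ^ (k / 2) else 0

theorem gaussianMoment_two_mul (s : ℝ) (m : ℕ) :
    gaussianMoment s (2 * m) = ((2 * m)! : ℂ) / (m ! : ℂ) * (s : ℂ) ^ m := by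
  simp [gaussianMoment]

theorem tendsto_norm_gaussianMoment_div_factorial (s : ℝ) :
    Tendsto (fun m => ‖gaussianMoment s (2 * m)‖ / (2 * m)!) atTop (nhds 0) := by
  refine (FloorSemiring.tendsto_pow_div_factorial_atTop |s|).congr fun m => ?_
  have : ((2 * m)! : ℝ) ≠ 0 := by exact_mod_cast (2 * m).factorial_ne_zero
  rw [gaussianMoment_two_mul]
  simp only [norm_mul, norm_div, norm_pow, Complex.norm_natCast, Complex.norm_real, Real.norm_eq_abs]
  field_simp

theorem tendsto_sum_gaussianMoment (s : ℝ) :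
    Tendsto (fun m => ∑ k ∈ Finset.range (2 * m), Complex.I ^ k / (k ! : ℂ) * gaussianMoment s k)
      atTop (nhds (Complex.exp (-s))) := by
  have hexp := (NormedSpace.expSeries_div_hasSum_exp (-(s : ℂ))).tendsto_sum_nat
  rw [← Complex.exp_eq_exp_ℂ] at hexp
  refine hexp.congr fun m => ?_
  induction m with
  | zero => simp
  | succ m ih =>
    have hodd : gaussianMoment s (2 * m + 1) = 0 := by simp [gaussianMoment]
    have : ((2 * m)! : ℂ) ≠ 0 := by exact_mod_cast (2 * m).factorial_ne_zero
    rw [show 2 * (m + 1) = 2 * m + 1 + 1 by ring, Finset.sum_range_succ, Finset.sum_range_succ,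
      Finset.sum_range_succ, ih, hodd, gaussianMoment_two_mul, pow_mul, Complex.I_sq, neg_pow]
    field_simp
    simp

theorem ofReal_inner_eq (z t : ℂ) :
    ((inner ℝ z t : ℝ) : ℂ) = z * ((starRingEnd ℂ) t / 2) + (starRingEnd ℂ) z * (t / 2) := by
  apply Complex.ext <;> simp [Complex.inner, Complex.mul_re, Complex.mul_im] <;> ring

theorem sum_choose_mul_eq_gaussianMoment (σ : ℝ) (t : ℂ) (k : ℕ) :
    ∑ j ∈ Finset.range (k + 1),
      ((starRingEnd ℂ) t / 2) ^ j * (t / 2) ^ (k - j) * (k.choose j : ℂ) *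
        (if j = k - j then (2 : ℂ) ^ j * (j ! : ℂ) * (σ : ℂ) ^ j else 0) =
      gaussianMoment (‖t‖ ^ 2 * σ / 2) k := by
  rcases Nat.even_or_odd' k with ⟨m, rfl | rfl⟩
  · rw [Finset.sum_eq_single_of_mem m (by simp; omega)
      (fun j hj hne => by rw [if_neg (by simp at hj; omega), mul_zero]),
      if_pos (by omega), gaussianMoment_two_mul, show 2 * m - m = m by omega,
      Nat.cast_choose ℂ (by omega : m ≤ 2 * m), show 2 * m - m = m by omega]
    have : (m ! : ℂ) ≠ 0 := by exact_mod_cast m.factorial_ne_zero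
    have ht : (((‖t‖ ^ 2 * σ / 2 : ℝ)) : ℂ) = (starRingEnd ℂ) t / 2 * (t / 2) * 2 * σ := by
      push_cast
      rw [← Complex.conj_mul' t]
      ring
    rw [ht]
    simp only [mul_pow]
    field_simp
  · rw [Finset.sum_eq_zero fun j hj => by rw [if_neg (by omega), mul_zero]]
    simp [gaussianMoment]

theorem tendsto_integral_inner_pow {σ : ℝ} {Ω : ℕ → Type*} [∀ n, MeasurableSpace (Ω n)]
    {μ : ∀ n, Measure (Ω n)} {X : ∀ n, Ω n → ℂ} (hmeas : ∀ n, Measurable (X n))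
    (hint : ∀ n k : ℕ, Integrable (fun ω => ‖X n ω‖ ^ k) (μ n))
    (hmom : ∀ κ lam : ℕ,
      Tendsto (fun n => ∫ ω, (X n ω) ^ κ * (starRingEnd ℂ) (X n ω) ^ lam ∂(μ n)) atTop
        (nhds (if κ = lam then (2 : ℂ) ^ κ * (κ ! : ℂ) * (σ : ℂ) ^ κ else 0)))
    (t : ℂ) (k : ℕ) :
    Tendsto (fun n => ∫ ω, ((inner ℝ (X n ω) t : ℝ) : ℂ) ^ k ∂(μ n)) atTop
      (nhds (gaussianMoment (‖t‖ ^ 2 * σ / 2) k)) := by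
  have hmixed (n κ lam : ℕ) :
      Integrable (fun ω => (X n ω) ^ κ * (starRingEnd ℂ) (X n ω) ^ lam) (μ n) := by
    have hm := hmeas n
    refine (hint n (κ + lam)).mono' ?_ (.of_forall fun ω => by simp [pow_add])
    exact ((hm.pow_const κ).mul
      ((Complex.continuous_conj.measurable.comp hm).pow_const lam)).aestronglyMeasurable
  have hexpand (n : ℕ) : ∫ ω, ((inner ℝ (X n ω) t : ℝ) : ℂ) ^ k ∂(μ n) =
      ∑ j ∈ Finset.range (k + 1),
        ((starRingEnd ℂ) t / 2) ^ j * (t / 2) ^ (k - j) * (k.choose j : ℂ) *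
          ∫ ω, (X n ω) ^ j * (starRingEnd ℂ) (X n ω) ^ (k - j) ∂(μ n) := by
    simp_rw [← integral_const_mul]
    rw [← integral_finsetSum _ fun j _ => (hmixed n j (k - j)).const_mul _]
    refine integral_congr_ae (.of_forall fun ω => ?_)
    simp only
    rw [ofReal_inner_eq, add_pow]
    refine Finset.sum_congr rfl fun j _ => ?_
    rw [mul_pow, mul_pow]
    ring
  simp_rw [hexpand]
  rw [← sum_choose_mul_eq_gaussianMoment]
  exact tendsto_finsetSum _ fun j _ => (hmom j (k - j)).const_mul _

theorem charFun_map_gaussianReal_prod {σ : ℝ} (hσ : 0 ≤ σ) (t : ℂ) :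
    charFun (((gaussianReal 0 σ.toNNReal).prod (gaussianReal 0 σ.toNNReal)).map
      (fun p : ℝ × ℝ => (p.1 : ℂ) + p.2 * Complex.I)) t =
      Complex.exp (-((‖t‖ ^ 2 * σ / 2 : ℝ) : ℂ)) := by
  rw [charFun_apply, integral_map (by fun_prop) (by fun_prop)]
  have hsplit (p : ℝ × ℝ) :
      Complex.exp ((inner ℝ ((p.1 : ℂ) + p.2 * Complex.I) t : ℝ) * Complex.I) =
        Complex.exp (t.re * p.1 * Complex.I) * Complex.exp (t.im * p.2 * Complex.I) := by
    rw [← Complex.exp_add]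
    congr 1
    simp [Complex.inner]
    ring
  simp_rw [hsplit]
  rw [integral_prod_mul (fun x : ℝ => Complex.exp (t.re * x * Complex.I))
      (fun y : ℝ => Complex.exp (t.im * y * Complex.I)),
    ← charFun_apply_real, ← charFun_apply_real, charFun_gaussianReal, charFun_gaussianReal,
    ← Complex.exp_add]
  congr 1
  rw [Real.coe_toNNReal σ hσ, Complex.sq_norm, Complex.normSq_apply]
  push_cast
  ring

theorem stmt_12 (σ : ℝ) (hσ : 0 < σ)
    (Ω : ℕ → Type) (mΩ : ∀ n, MeasurableSpace (Ω n)) (μ : ∀ n, Measure (Ω n))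
    (hprob : ∀ n, IsProbabilityMeasure (μ n))
    (X : ∀ n, Ω n → ℂ) (hmeas : ∀ n, Measurable (X n))
    (hint : ∀ n k : ℕ, Integrable (fun ω => ‖X n ω‖ ^ k) (μ n))
    (hmom : ∀ κ lam : ℕ,
      Tendsto (fun n => ∫ ω, (X n ω) ^ κ * (starRingEnd ℂ) (X n ω) ^ lam ∂(μ n))
        atTop
        (nhds (if κ = lam then (2 : ℂ) ^ κ * (Nat.factorial κ : ℂ) * (σ : ℂ) ^ κ else 0))) :
    ∀ g : BoundedContinuousFunction ℂ ℝ,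
      Tendsto (fun n => ∫ ω, g (X n ω) ∂(μ n)) atTop
        (nhds (∫ z, g z
          ∂(((gaussianReal 0 σ.toNNReal).prod (gaussianReal 0 σ.toNNReal)).map
              (fun p : ℝ × ℝ => (p.1 : ℂ) + p.2 * Complex.I)))) := by
  intro g
  let law (n : ℕ) : ProbabilityMeasure ℂ :=
    ⟨(μ n).map (X n), Measure.isProbabilityMeasure_map (hmeas n).aemeasurable⟩
  let gauss : ProbabilityMeasure ℂ :=
    ⟨((gaussianReal 0 σ.toNNReal).prod (gaussianReal 0 σ.toNNReal)).map
      (fun p : ℝ × ℝ => (p.1 : ℂ) + p.2 * Complex.I),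
      Measure.isProbabilityMeasure_map (by fun_prop)⟩
  have hlaw : Tendsto law atTop (nhds gauss) := by
    refine ProbabilityMeasure.tendsto_of_tendsto_charFun fun t => ?_
    have hY (n : ℕ) : Measurable fun ω => (inner ℝ (X n ω) t : ℝ) :=
      (hmeas n).inner measurable_const
    have hintY (n k : ℕ) : Integrable (fun ω => (inner ℝ (X n ω) t : ℝ) ^ k) (μ n) := by
      refine ((hint n k).mul_const (‖t‖ ^ k)).mono' ((hY n).pow_const k).aestronglyMeasurable
        (.of_forall fun ω => ?_)
      rw [norm_pow, ← mul_pow]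
      exact pow_le_pow_left₀ (norm_nonneg _) (norm_inner_le_norm _ _) k
    have hlim := tendsto_integral_cexp_of_tendsto_moments hY hintY
      (tendsto_integral_inner_pow hmeas hint hmom t)
      (tendsto_norm_gaussianMoment_div_factorial _) (tendsto_sum_gaussianMoment _)
    have hcharFun (n : ℕ) : charFun (law n : Measure ℂ) t =
        ∫ ω, Complex.exp ((inner ℝ (X n ω) t : ℝ) * Complex.I) ∂(μ n) := by
      rw [charFun_apply]
      exact integral_map (hmeas n).aemeasurable (by fun_prop)
    simp_rw [hcharFun]
    convert! hlim using 2
    exact charFun_map_gaussianReal_prod hσ.le t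
  refine (ProbabilityMeasure.tendsto_iff_forall_integral_tendsto.1 hlaw g).congr fun n => ?_
  exact integral_map (hmeas n).aemeasurable (by fun_prop)
end
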